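/- There is no infinite word w : ℕ → Σ₃ that simultaneously contains no factor of exponent 5/2 or greater, has factor complexity equal to 2n+1 for every n ≥ 0, and contains none of the words 02, 10, 11, 22 as a factor. -/

import Mathlib

/-! Common definitions: the alphabet Σ₃, finite and infinite words, factors,
factor complexity, periods and exponents, morphisms, the morphism γ and its
fixed point G = γ^ω(0). -/

abbrev Sigma3 := Fin 3
abbrev Word := List Sigma3
abbrev InfWord := ℕ → Sigma3

/-- `u` is a factor of the infinite word `w`. -/
def IsFactor (u : Word) (w : InfWord) : Prop :=
  ∃ i : ℕ, u = (List.range u.length).map (fun j => w (i + j))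

/-- The set of finite factors of `w`. -/
def Lang (w : InfWord) : Set Word := {u | IsFactor u w}

/-- Factor complexity: the number of distinct length-`n` factors of `w`. -/
noncomputable def complexity (w : InfWord) (n : ℕ) : ℕ :=
  Set.ncard {u : Word | IsFactor u w ∧ u.length = n}

/-- `v` has period `p` (with `p ≥ 1`). -/
def HasPeriod (v : Word) (p : ℕ) : Prop :=
  1 ≤ p ∧ ∀ i, i + p < v.length → v.getD i 0 = v.getD (i + p) 0

/-- The least period of `v`. -/
noncomputable def minPeriod (v : Word) : ℕ := sInf {p | HasPeriod v p}

/-- The exponent `|v| / p` of a nonempty finite word `v`, where `p` is its least period. -/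
noncomputable def expo (v : Word) : ℝ := (v.length : ℝ) / (minPeriod v : ℝ)

/-- `w` contains no factor of exponent `5/2` or greater. -/
def NoFiveHalves (w : InfWord) : Prop :=
  ∀ u : Word, u ≠ [] → IsFactor u w → expo u < 5 / 2

/-- Apply a morphism (given by the images of the three letters) to a finite word. -/
def applyM (f : Sigma3 → Word) (u : Word) : Word := (u.map f).flatten

/-- The image under `f` of the length-`k` prefix of the infinite word `u`. -/
def imPrefix (f : Sigma3 → Word) (u : InfWord) (k : ℕ) : Word :=
  applyM f ((List.range k).map u)

/-- The image of an infinite word under a (non-erasing) morphism. -/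
def applyMInf (f : Sigma3 → Word) (u : InfWord) : InfWord :=
  fun n => (imPrefix f u (n + 1)).getD n 0

/-- The morphism `γ = [01, 2, 02]`. -/
def gam : Sigma3 → Word := ![[0, 1], [2], [0, 2]]

/-- The fixed point `G = γ^ω(0)` of `γ`, the unique infinite fixed point beginning with 0. -/
def G : InfWord := fun n => ((applyM gam)^[n + 1] [0]).getD n 0

/-- The final segment of `w` starting at position `k`. -/
def shift (w : InfWord) (k : ℕ) : InfWord := fun i => w (i + k)

/-- The reverse `h^R` of a morphism `h`. -/
def mR (f : Sigma3 → Word) : Sigma3 → Word := fun x => (f x).reverse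

/-! A depth-first search over words, stored in reverse (latest letter first), shows that `00` has
no long extension to the right that satisfies all the constraints. Only the bound on the number of
factors of length five and periods up to `20` are used. -/

/-- `r` begins with a word of period `p` and length at least `5 * p / 2`. -/
def hasHighPower (r : Word) (p : ℕ) : Bool :=
  Nat.ble ((5 * p + 1) / 2) r.length &&
    r.take ((5 * p + 1) / 2 - p) == (r.drop p).take ((5 * p + 1) / 2 - p)

/-- The reversed word `r` begins with the reversal of one of `02`, `10`, `11`, `22`. -/
def hasBadPair : Word → Bool
  | x :: y :: _ => [[0, 2], [1, 0], [1, 1], [2, 2]].contains [y, x]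
  | _ => false

/-- Add the first five letters of `r` to the list `F`, unless `r` is shorter or they are there. -/
def addWindow (r : Word) (F : List Word) : List Word :=
  if Nat.ble 5 r.length && !F.contains (r.take 5) then r.take 5 :: F else F

/-- The reversed word `r`, with reversed factors `F` of length five, can be discarded. -/
def isBad (r : Word) (F : List Word) : Bool :=
  hasBadPair r || Nat.blt 11 F.length || (List.range 20).any fun p => hasHighPower r (p + 1)

/-- Every extension of the reversed word `r` by `n` letters can be discarded. -/
def isDead : ℕ → Word → List Word → Bool
  | 0, _, _ => false
  | n + 1, r, F => [0, 1, 2].all fun x =>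
      isBad (x :: r) (addWindow (x :: r) F) || isDead n (x :: r) (addWindow (x :: r) F)

/-- The factor of `w` of length `k` at position `i`, reversed. -/
def revWindow (w : InfWord) (i k : ℕ) : Word :=
  ((List.range k).map fun j => w (i + j)).reverse

lemma revWindow_succ (w : InfWord) (i k : ℕ) :
    revWindow w i (k + 1) = w (i + k) :: revWindow w i k := by
  simp [revWindow, List.range_succ]

@[simp] lemma length_revWindow (w : InfWord) (i k : ℕ) : (revWindow w i k).length = k := by
  simp [revWindow]

lemma getElem_revWindow (w : InfWord) (i k j : ℕ) (h : j < (revWindow w i k).length) :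
    (revWindow w i k)[j] = w (i + (k - 1 - j)) := by
  simp [revWindow]

lemma take_revWindow (w : InfWord) (i k m : ℕ) (h : m ≤ k) :
    (revWindow w i k).take m = revWindow w (i + (k - m)) m := by
  apply List.ext_getElem
  · simp [h]
  · intro j h₁ h₂
    simp only [List.getElem_take, getElem_revWindow]
    simp only [length_revWindow] at h₂
    congr 1
    omega

lemma isFactor_reverse_revWindow (w : InfWord) (i k : ℕ) :
    IsFactor (revWindow w i k).reverse w :=
  ⟨i, by simp [revWindow]⟩

lemma HasPeriod.two_mul_length_lt {w : InfWord} (hw : NoFiveHalves w) {v : Word} {p : ℕ}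
    (hv : IsFactor v w) (hne : v ≠ []) (hp : HasPeriod v p) : 2 * v.length < 5 * p := by
  have hle : minPeriod v ≤ p := Nat.sInf_le hp
  have hpos : 1 ≤ minPeriod v := (Nat.sInf_mem (s := {p | HasPeriod v p}) ⟨p, hp⟩).1
  have h := hw v hne hv
  have hpos' : (0 : ℝ) < minPeriod v := by exact_mod_cast hpos
  rw [expo, div_lt_div_iff₀ hpos' two_pos] at h
  have h' : v.length * 2 < 5 * minPeriod v := by exact_mod_cast h
  omega

lemma hasHighPower_revWindow {w : InfWord} (hw : NoFiveHalves w) (i k p : ℕ) (hp : 1 ≤ p) :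
    hasHighPower (revWindow w i k) p = false := by
  by_contra h
  simp only [hasHighPower, Bool.not_eq_false, Bool.and_eq_true, Nat.ble_eq, length_revWindow,
    beq_iff_eq] at h
  obtain ⟨hm, heq⟩ := h
  set m := (5 * p + 1) / 2 with hmdef
  have hlen : (revWindow w (i + (k - m)) m).reverse.length = m := by simp
  have hper : HasPeriod (revWindow w (i + (k - m)) m).reverse p := by
    refine ⟨hp, fun j hj => ?_⟩
    rw [hlen] at hj
    have hget := congrArg (fun l : Word => l[m - 1 - j - p]?) heq
    have h₁ : m - 1 - j - p < m - p := by omega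
    have h₂ : m - 1 - j - p < k := by omega
    have h₃ : p + (m - 1 - j - p) < k := by omega
    simp only [List.getElem?_take, h₁, if_true, List.getElem?_drop, List.getElem?_eq_getElem,
      length_revWindow, h₂, h₃, getElem_revWindow, Option.some.injEq] at hget
    rw [List.getD_eq_getElem _ _ (by omega), List.getD_eq_getElem _ _ (by omega)]
    simp only [List.getElem_reverse, getElem_revWindow, length_revWindow]
    convert hget.symm using 2 <;> omega
  have := hper.two_mul_length_lt hw (isFactor_reverse_revWindow _ _ _)
    (List.ne_nil_of_length_pos (by omega))
  omega

lemma hasBadPair_revWindow {w : InfWord}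
    (hw : ∀ u ∈ [[0, 2], [1, 0], [1, 1], [2, 2]], ¬ IsFactor u w) (i k : ℕ) :
    hasBadPair (revWindow w i k) = false := by
  match k with
  | 0 => rfl
  | 1 => rfl
  | k + 2 =>
    rw [revWindow_succ, revWindow_succ, hasBadPair]
    by_contra h
    rw [Bool.not_eq_false, List.contains_iff_mem] at h
    exact hw _ h ⟨i + k, by simp [List.range_succ, add_assoc]⟩

/-- `F` lists distinct reversed factors of `w` of length five. -/
def IsWindowList (w : InfWord) (F : List Word) : Prop :=
  F.Nodup ∧ ∀ u ∈ F, IsFactor u.reverse w ∧ u.reverse.length = 5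

lemma IsWindowList.addWindow {w : InfWord} {F : List Word} (hF : IsWindowList w F) (i k : ℕ) :
    IsWindowList w (addWindow (revWindow w i k) F) := by
  unfold _root_.addWindow
  split_ifs with h
  · simp only [length_revWindow, Bool.and_eq_true, Nat.ble_eq, Bool.not_eq_true',
      ← Bool.not_eq_true, List.contains_iff_mem] at h
    refine ⟨List.nodup_cons.2 ⟨h.2, hF.1⟩, List.forall_mem_cons.2 ⟨?_, hF.2⟩⟩
    rw [take_revWindow _ _ _ _ h.1]
    exact ⟨isFactor_reverse_revWindow _ _ _, by simp⟩
  · exact hF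

lemma IsWindowList.length_le {w : InfWord} (hw : complexity w 5 = 11) {F : List Word}
    (hF : IsWindowList w F) : F.length ≤ 11 := by
  have hfin : {u : Word | IsFactor u w ∧ u.length = 5}.Finite :=
    Set.finite_of_ncard_pos (by rw [← complexity, hw]; norm_num)
  have hnd : (F.map List.reverse).Nodup := hF.1.map List.reverse_injective
  rw [← hw, complexity, ← List.length_map (as := F) List.reverse,
    ← List.toFinset_card_of_nodup hnd, ← Set.ncard_coe_finset]
  refine Set.ncard_le_ncard (fun u hu => ?_) hfin
  simp only [List.coe_toFinset, List.mem_map, Set.mem_ofPred_eq] at hu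
  obtain ⟨v, hv, rfl⟩ := hu
  exact hF.2 v hv

lemma isDead_revWindow {w : InfWord} (hpow : NoFiveHalves w) (hcompl : complexity w 5 = 11)
    (hpair : ∀ u ∈ [[0, 2], [1, 0], [1, 1], [2, 2]], ¬ IsFactor u w) (i n k : ℕ)
    {F : List Word} (hF : IsWindowList w F) : isDead n (revWindow w i k) F = false := by
  induction n generalizing k F with
  | zero => rfl
  | succ n ih =>
    rw [isDead, List.all_eq_false]
    refine ⟨w (i + k), by generalize w (i + k) = x; revert x; decide, ?_⟩
    rw [← revWindow_succ, ih _ (hF.addWindow i (k + 1)), isBad, hasBadPair_revWindow hpair,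
      List.any_eq_false.2 fun p _ => by
        rw [hasHighPower_revWindow hpow i (k + 1) (p + 1) p.succ_pos]; decide]
    simpa [Nat.blt, Nat.lt_succ_iff] using (hF.addWindow i (k + 1)).length_le hcompl

lemma isDead_zero_zero : isDead 60 [0, 0] [] = true := by
  decide +kernel

lemma isFactor_zero_zero {w : InfWord} (hcompl : complexity w 2 = 5)
    (hpair : ∀ u ∈ [[0, 2], [1, 0], [1, 1], [2, 2]], ¬ IsFactor u w) : IsFactor [0, 0] w := by
  by_contra h
  have hsub : {u : Word | IsFactor u w ∧ u.length = 2} ⊆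
      (({[0, 1], [1, 2], [2, 0], [2, 1]} : Finset Word) : Set Word) := by
    rintro u ⟨hu, hlen⟩
    obtain ⟨a, b, rfl⟩ := List.length_eq_two.1 hlen
    have hmem : [a, b] ∉ ([[0, 2], [1, 0], [1, 1], [2, 2], [0, 0]] : List Word) := by
      intro hab
      have : ∀ v ∈ ([[0, 2], [1, 0], [1, 1], [2, 2], [0, 0]] : List Word), ¬ IsFactor v w := by
        simp only [List.forall_mem_cons] at hpair ⊢
        tauto
      exact this _ hab hu
    clear hu hlen
    rw [Finset.mem_coe]
    revert a b
    decide
  have hle := Set.ncard_le_ncard hsub (Finset.finite_toSet _)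
  rw [← complexity, hcompl, Set.ncard_coe_finset] at hle
  revert hle
  decide

/-- There is no infinite word over Σ₃ avoiding exponents `≥ 5/2`, with factor
complexity `2n+1`, omitting all the listed factors. -/
theorem stmt16 :
    ¬ ∃ w : InfWord, NoFiveHalves w ∧ (∀ n : ℕ, complexity w n = 2 * n + 1) ∧
      (¬ IsFactor [0, 2] w ∧
      ¬ IsFactor [1, 0] w ∧
      ¬ IsFactor [1, 1] w ∧
      ¬ IsFactor [2, 2] w) := by
  rintro ⟨w, hpow, hcompl, h02, h10, h11, h22⟩
  have hpair : ∀ u ∈ [[0, 2], [1, 0], [1, 1], [2, 2]], ¬ IsFactor u w := by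
    simp [h02, h10, h11, h22]
  obtain ⟨i, hi⟩ := isFactor_zero_zero (hcompl 2) hpair
  have hdead := isDead_revWindow hpow (hcompl 5) hpair i 60 2 (F := []) ⟨List.nodup_nil, by simp⟩
  have hrev : revWindow w i 2 = [0, 0] := by
    have := congrArg List.reverse hi
    simpa [revWindow] using this.symm
  rw [hrev, isDead_zero_zero] at hdead
  exact absurd hdead (by decide)
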